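/- Fix integers r, s ≥ 1 and nonnegative integers u₁,…,u_{r+s}, t₁,…,t_{r+s}. Then the formal q-series ∑ over (n₁,…,n_r ≥ 0, d₁,…,d_r ≥ 1, n_{r+1},…,n_{r+s} ≥ 1, d_{r+1},…,d_{r+s} ≥ 1) subject to d₁+⋯+d_r = d_{r+1}+⋯+d_{r+s}, of ∏_{i=1}^{r+s} n_i^{u_i} d_i^{t_i} · q^{∑_{i=1}^{r+s} n_i d_i}, lies in the ℚ-vector space BD spanned by bi-brackets; it is a finite ℚ-linear combination of bi-brackets of weight at most ∑_{i=1}^{r+s}(u_i+t_i+1), and if all t_i ≥ 1, of bi-brackets with first upper index t'₁ ≥ 2 (i.e., it lies in qBD). -/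

import Mathlib

open Finset

/-- The unordered sum ∑_{n₁,…,n_r ≥ 0, n_{r+1},…,n_{r+s} ≥ 1, all dᵢ ≥ 1,
d₁+⋯+d_r = d_{r+1}+⋯+d_{r+s}} ∏ nᵢ^{uᵢ} dᵢ^{tᵢ} q^{∑ nᵢdᵢ} ∈ ℚ[[q]]. -/
noncomputable def unordSum (r s : ℕ) (u t : Fin (r + s) → ℕ) : PowerSeries ℚ :=
  PowerSeries.mk fun N =>
    ∑ p ∈ ((Fintype.piFinset fun _ : Fin (r + s) => Finset.range ((r + s) * N + 2)) ×ˢ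
        (Fintype.piFinset fun _ : Fin (r + s) => Finset.range ((r + s) * N + 2))).filter
      (fun p => (∀ i, 1 ≤ p.2 i) ∧ (∀ i : Fin (r + s), r ≤ (i : ℕ) → 1 ≤ p.1 i) ∧
        (∑ i ∈ Finset.univ.filter (fun i : Fin (r + s) => (i : ℕ) < r), p.2 i)
          = (∑ i ∈ Finset.univ.filter (fun i : Fin (r + s) => r ≤ (i : ℕ)), p.2 i) ∧
        (∑ i, p.1 i * p.2 i) = N),
      ∏ i, (p.1 i : ℚ) ^ (u i) * (p.2 i : ℚ) ^ (t i)

/-- The ordered sum ∑_{n₁>⋯>n_f ≥ 0, n_{f+1}>⋯>n_{f+g} ≥ 1, all dᵢ ≥ 1,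
d₁+⋯+d_f = d_{f+1}+⋯+d_{f+g}} ∏ nᵢ^{uᵢ} dᵢ^{tᵢ} q^{∑ nᵢdᵢ} ∈ ℚ[[q]]. -/
noncomputable def ordSum (f g : ℕ) (u t : Fin (f + g) → ℕ) : PowerSeries ℚ :=
  PowerSeries.mk fun N =>
    ∑ p ∈ ((Fintype.piFinset fun _ : Fin (f + g) => Finset.range ((f + g) * N + 2)) ×ˢ
        (Fintype.piFinset fun _ : Fin (f + g) => Finset.range ((f + g) * N + 2))).filter
      (fun p => (∀ i, 1 ≤ p.2 i) ∧ (∀ i : Fin (f + g), f ≤ (i : ℕ) → 1 ≤ p.1 i) ∧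
        (∀ i j : Fin (f + g), i < j → (j : ℕ) < f → p.1 j < p.1 i) ∧
        (∀ i j : Fin (f + g), i < j → f ≤ (i : ℕ) → p.1 j < p.1 i) ∧
        (∑ i ∈ Finset.univ.filter (fun i : Fin (f + g) => (i : ℕ) < f), p.2 i)
          = (∑ i ∈ Finset.univ.filter (fun i : Fin (f + g) => f ≤ (i : ℕ)), p.2 i) ∧
        (∑ i, p.1 i * p.2 i) = N),
      ∏ i, (p.1 i : ℚ) ^ (u i) * (p.2 i : ℚ) ^ (t i)

/-- The bi-bracket [s₁,…,s_ℓ; r₁,…,r_ℓ] = ∑_{u₁>⋯>u_ℓ>0, vᵢ>0}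
∏ (uᵢ^{rᵢ}/rᵢ!)(vᵢ^{sᵢ-1}/(sᵢ-1)!) q^{∑ uᵢvᵢ} ∈ ℚ[[q]]. -/
noncomputable def bibracket (l : ℕ) (s r : Fin l → ℕ) : PowerSeries ℚ :=
  PowerSeries.mk fun N =>
    ∑ p ∈ ((Fintype.piFinset fun _ : Fin l => Finset.range (N + 1)) ×ˢ
        (Fintype.piFinset fun _ : Fin l => Finset.range (N + 1))).filter
      (fun p => (∀ i, 1 ≤ p.1 i) ∧ (∀ i, 1 ≤ p.2 i) ∧
        (∀ i j : Fin l, i < j → p.1 j < p.1 i) ∧ (∑ i, p.1 i * p.2 i) = N),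
      ∏ i, ((p.1 i : ℚ) ^ (r i) / ((r i).factorial : ℚ)) *
        ((p.2 i : ℚ) ^ (s i - 1) / ((s i - 1).factorial : ℚ))

/-- The power series `∑_{m ≥ e} m ^ a X ^ m`. -/
noncomputable def powSeries (e a : ℕ) : PowerSeries ℚ :=
  PowerSeries.mk fun n => if n < e then 0 else (n : ℚ) ^ a

theorem coeff_powSeries (e a n : ℕ) :
    PowerSeries.coeff n (powSeries e a) = if n < e then 0 else (n : ℚ) ^ a := by
  simp [powSeries]

theorem powSeries_zero_mul_one_eq (a b : ℕ) :
    powSeries 0 a * powSeries 1 b = ∑ j ∈ range (b + 1), ∑ i ∈ range (a + j + 1),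
      ((b.choose j : ℚ) * (-1) ^ j * (bernoulli i * ((a + j + 1).choose i) / ((a + j : ℕ) + 1))) •
        powSeries 1 ((a + j + 1 - i) + (b - j)) := by
  ext D
  rcases Nat.eq_zero_or_pos D with rfl | hD
  · simp [powSeries, PowerSeries.coeff_mul]
  have hD' : ¬ D < 1 := by omega
  simp only [map_sum, PowerSeries.coeff_smul, coeff_powSeries, hD', if_false, smul_eq_mul]
  rw [PowerSeries.coeff_mul, Finset.Nat.sum_antidiagonal_eq_sum_range_succ_mk, sum_range_succ]
  simp only [coeff_powSeries, Nat.sub_self, Nat.not_lt_zero, if_false, zero_lt_one, if_true,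
    mul_zero, add_zero]
  have h1 : ∀ m ∈ range D, (m : ℚ) ^ a * (if D - m < 1 then 0 else ((D - m : ℕ) : ℚ) ^ b)
      = ∑ j ∈ range (b + 1), (b.choose j : ℚ) * (-1) ^ j * (D : ℚ) ^ (b - j) * (m : ℚ) ^ (a + j) := by
    intro m hm
    have hm' := mem_range.1 hm
    rw [if_neg (by omega), Nat.cast_sub hm'.le, sub_eq_neg_add, add_pow, mul_sum]
    refine sum_congr rfl fun j _ => ?_
    rw [neg_pow, pow_add]
    ring
  rw [sum_congr rfl h1, sum_comm]
  refine sum_congr rfl fun j _ => ?_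
  rw [← mul_sum, sum_range_pow, mul_sum]
  refine sum_congr rfl fun i _ => ?_
  rw [pow_add]
  push_cast
  ring

theorem exists_powSeries_zero_mul_one (a b : ℕ) : ∃ c : ℕ → ℚ,
    powSeries 0 a * powSeries 1 b = ∑ j ∈ Icc 1 (a + b + 1), c j • powSeries 1 j := by
  have h : powSeries 0 a * powSeries 1 b ∈
      Submodule.span ℚ (powSeries 1 '' (Icc 1 (a + b + 1) : Finset ℕ)) := by
    rw [powSeries_zero_mul_one_eq]
    refine sum_mem fun j hj => sum_mem fun i hi => Submodule.smul_mem _ _ (Submodule.subset_span ?_)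
    rw [mem_range] at hi hj
    exact ⟨_, by simp only [coe_Icc, Set.mem_Icc]; omega, rfl⟩
  obtain ⟨c, hc⟩ := (Submodule.mem_span_image_finset_iff_exists_fun' ℚ).1 h
  exact ⟨c, hc.symm⟩

theorem powSeries_one_eq (a : ℕ) :
    powSeries 1 a = powSeries 0 a - if a = 0 then 1 else 0 := by
  ext n
  rcases Nat.eq_zero_or_pos n with rfl | hn
  · by_cases ha : a = 0 <;>
      simp [coeff_powSeries, ha, PowerSeries.coeff_one,
        -PowerSeries.coeff_zero_eq_constantCoeff]
  · by_cases ha : a = 0 <;>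
      simp [coeff_powSeries, ha, PowerSeries.coeff_one, Nat.pos_iff_ne_zero.1 hn]

theorem exists_powSeries_one_mul_one (a b : ℕ) : ∃ c : ℕ → ℚ,
    powSeries 1 a * powSeries 1 b = ∑ j ∈ range (a + b + 2), c j • powSeries 1 j := by
  have h : powSeries 1 a * powSeries 1 b ∈
      Submodule.span ℚ (powSeries 1 '' (range (a + b + 2) : Finset ℕ)) := by
    obtain ⟨c, hc⟩ := exists_powSeries_zero_mul_one a b
    rw [powSeries_one_eq a, sub_mul, hc]
    refine sub_mem (sum_mem fun j hj => Submodule.smul_mem _ _ (Submodule.subset_span ?_)) ?_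
    · rw [mem_Icc] at hj
      exact ⟨j, by simp only [coe_range, Set.mem_Iio]; omega, rfl⟩
    · split_ifs
      · rw [one_mul]
        exact Submodule.subset_span ⟨b, by simp only [coe_range, Set.mem_Iio]; omega, rfl⟩
      · simp
  obtain ⟨c, hc⟩ := (Submodule.mem_span_image_finset_iff_exists_fun' ℚ).1 h
  exact ⟨c, hc.symm⟩

/-- The Lambert-type series `∑_{m ≥ e} m ^ a X ^ (m d)` for `d ≥ 1`, and `0` for `d = 0`. -/
noncomputable def lambert (e a d : ℕ) : PowerSeries ℚ :=
  if h : d = 0 then 0 else PowerSeries.expand d h (powSeries e a)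

theorem coeff_lambert {d : ℕ} (hd : 1 ≤ d) (e a : ℕ) {n B : ℕ} (hB : n < B) :
    PowerSeries.coeff n (lambert e a d) =
      ∑ m ∈ Ico e B, if m * d = n then (m : ℚ) ^ a else 0 := by
  have hd0 : d ≠ 0 := by omega
  rw [lambert, dif_neg hd0, PowerSeries.coeff_expand]
  split_ifs with h
  · obtain ⟨k, rfl⟩ := h
    have hk : k ≤ d * k := Nat.le_mul_of_pos_left _ hd
    rw [Nat.mul_div_cancel_left _ hd, coeff_powSeries]
    have : ∀ m, (m * d = d * k) ↔ k = m := fun m => by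
      rw [mul_comm d k, Nat.mul_left_inj hd0, eq_comm]
    simp only [this, sum_ite_eq, mem_Ico]
    by_cases hke : k < e
    · rw [if_pos hke, if_neg (by omega)]
    · rw [if_neg hke, if_pos (by omega)]
  · refine (sum_eq_zero fun m _ => if_neg fun hm => h ⟨m, by rw [← hm, mul_comm]⟩).symm

theorem exists_lambert_zero_mul_one (a b : ℕ) : ∃ c : ℕ → ℚ, ∀ d,
    lambert 0 a d * lambert 1 b d = ∑ j ∈ Icc 1 (a + b + 1), c j • lambert 1 j d := by
  obtain ⟨c, hc⟩ := exists_powSeries_zero_mul_one a b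
  refine ⟨c, fun d => ?_⟩
  by_cases hd : d = 0
  · simp [lambert, hd]
  · simp only [lambert, dif_neg hd]
    rw [← map_mul, hc]
    simp

theorem exists_lambert_one_mul_one (a b : ℕ) : ∃ c : ℕ → ℚ, ∀ d,
    lambert 1 a d * lambert 1 b d = ∑ j ∈ range (a + b + 2), c j • lambert 1 j d := by
  obtain ⟨c, hc⟩ := exists_powSeries_one_mul_one a b
  refine ⟨c, fun d => ?_⟩
  by_cases hd : d = 0
  · simp [lambert, hd]
  · simp only [lambert, dif_neg hd]
    rw [← map_mul, hc]
    simp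

section TruncatedProducts

variable {S : Type*} [CommRing S]

theorem coeff_mul_congr {N : ℕ} {f f' g g' : PowerSeries S}
    (hf : ∀ n ≤ N, PowerSeries.coeff n f = PowerSeries.coeff n f')
    (hg : ∀ n ≤ N, PowerSeries.coeff n g = PowerSeries.coeff n g') :
    ∀ n ≤ N, PowerSeries.coeff n (f * g) = PowerSeries.coeff n (f' * g') := by
  intro n hn
  rw [PowerSeries.coeff_mul, PowerSeries.coeff_mul]
  refine sum_congr rfl fun p hp => ?_
  have := HasAntidiagonal.mem_antidiagonal.1 hp
  rw [hf _ (by omega), hg _ (by omega)]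

theorem coeff_prod_congr {ι : Type*} (s : Finset ι) {N : ℕ} {f g : ι → PowerSeries S}
    (h : ∀ i ∈ s, ∀ n ≤ N, PowerSeries.coeff n (f i) = PowerSeries.coeff n (g i)) :
    ∀ n ≤ N, PowerSeries.coeff n (∏ i ∈ s, f i) = PowerSeries.coeff n (∏ i ∈ s, g i) := by
  classical
  induction s using Finset.induction_on with
  | empty => simp
  | insert i s hi ih =>
    rw [prod_insert hi, prod_insert hi]
    exact coeff_mul_congr (h i (mem_insert_self _ _))
      (ih fun j hj => h j (mem_insert_of_mem hj))

/-- The coefficient of a product of series, each known up to the relevant order as a finite sum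
of monomials. -/
theorem coeff_prod_of_sum_monomial {ι κ : Type*} [Fintype ι] [DecidableEq ι] {N : ℕ}
    (f : ι → PowerSeries S) (s : ι → Finset κ) (k : ι → κ → ℕ) (c : ι → κ → S)
    (h : ∀ i, ∀ n ≤ N, PowerSeries.coeff n (f i) =
      PowerSeries.coeff n (∑ m ∈ s i, PowerSeries.monomial (k i m) (c i m))) :
    PowerSeries.coeff N (∏ i, f i) =
      ∑ n ∈ Fintype.piFinset s, if ∑ i, k i (n i) = N then ∏ i, c i (n i) else 0 := by
  rw [coeff_prod_congr univ (fun i _ => h i) N le_rfl, prod_univ_sum, map_sum]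
  refine sum_congr rfl fun n _ => ?_
  rw [PowerSeries.prod_monomial, PowerSeries.coeff_monomial]
  simp only [eq_comm]

end TruncatedProducts

theorem coeff_lambert_eq_coeff_sum {d : ℕ} (hd : 1 ≤ d) (e a : ℕ) {N B : ℕ} (hB : N < B) :
    ∀ n ≤ N, PowerSeries.coeff n (lambert e a d) =
      PowerSeries.coeff n (∑ m ∈ Ico e B, PowerSeries.monomial (m * d) ((m : ℚ) ^ a)) := by
  intro n hn
  rw [coeff_lambert hd e a (hn.trans_lt hB)]
  simp only [map_sum, PowerSeries.coeff_monomial, eq_comm]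

theorem coeff_prod_lambert {ι : Type*} [Fintype ι] [DecidableEq ι] {N B : ℕ} (hB : N < B)
    (e a d : ι → ℕ) (hd : ∀ i, 1 ≤ d i) :
    PowerSeries.coeff N (∏ i, lambert (e i) (a i) (d i)) =
      ∑ n ∈ Fintype.piFinset (fun i => Ico (e i) B),
        if ∑ i, n i * d i = N then ∏ i, (n i : ℚ) ^ a i else 0 :=
  coeff_prod_of_sum_monomial _ _ (fun i m => m * d i) (fun i m => (m : ℚ) ^ a i)
    fun i => coeff_lambert_eq_coeff_sum (hd i) _ _ hB

theorem coeff_lambert_mul_lambert {d d' : ℕ} (hd : 1 ≤ d) (hd' : 1 ≤ d') (e a e' b : ℕ)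
    {N B : ℕ} (hB : N < B) :
    PowerSeries.coeff N (lambert e a d * lambert e' b d') =
      ∑ p ∈ (Ico e B ×ˢ Ico e' B) with p.1 * d + p.2 * d' = N, (p.1 : ℚ) ^ a * (p.2 : ℚ) ^ b := by
  rw [coeff_mul_congr (coeff_lambert_eq_coeff_sum hd e a hB)
    (coeff_lambert_eq_coeff_sum hd' e' b hB) N le_rfl, sum_mul_sum, ← sum_product', map_sum,
    sum_filter]
  refine sum_congr rfl fun p _ => ?_
  rw [PowerSeries.monomial_mul_monomial, PowerSeries.coeff_monomial]
  simp only [eq_comm]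

theorem coeff_sum_lambert_shift {d d' : ℕ} (hd : 1 ≤ d) (hd' : 1 ≤ d') (e a b : ℕ)
    {N B : ℕ} (hB : N < B) :
    PowerSeries.coeff N (∑ j ∈ range (b + 1), (b.choose j : ℚ) •
      (lambert e (a + (b - j)) (d + d') * lambert 1 j d')) =
      ∑ p ∈ (Ico e B ×ˢ Ico e B) with p.1 * d + p.2 * d' = N ∧ p.1 < p.2,
        (p.1 : ℚ) ^ a * (p.2 : ℚ) ^ b := by
  simp only [map_sum, PowerSeries.coeff_smul,
    coeff_lambert_mul_lambert (Nat.le_add_right_of_le hd : 1 ≤ d + d') hd' e _ 1 _ hB, smul_sum]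
  rw [sum_comm]
  refine sum_nbij' (fun p => (p.1, p.1 + p.2)) (fun p => (p.1, p.2 - p.1)) ?_ ?_ ?_ ?_ ?_
  · rintro ⟨m, k⟩ h
    simp only [mem_filter, mem_product, mem_Ico] at h ⊢
    obtain ⟨⟨h1, h2⟩, h3⟩ := h
    have : m + k ≤ (m + k) * d' := Nat.le_mul_of_pos_right _ hd'
    have h4 : m * d + (m + k) * d' = N := by rw [← h3]; ring
    exact ⟨⟨h1, by omega, by omega⟩, h4, by omega⟩
  · rintro ⟨m, k⟩ h
    simp only [mem_filter, mem_product, mem_Ico] at h ⊢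
    obtain ⟨⟨h1, h2⟩, h3, h4⟩ := h
    obtain ⟨k, rfl⟩ := Nat.exists_eq_add_of_le h4.le
    refine ⟨⟨h1, by omega, by omega⟩, ?_⟩
    rw [← h3, Nat.add_sub_cancel_left]
    ring
  · rintro ⟨m, k⟩ h
    simp
  · rintro ⟨m, k⟩ h
    simp only [mem_filter] at h
    simp only [Prod.mk.injEq, true_and]
    omega
  · rintro ⟨m, k⟩ h
    simp only [Nat.cast_add, smul_eq_mul]
    rw [add_comm (m : ℚ) k, add_pow, mul_sum]
    refine sum_congr rfl fun j _ => ?_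
    rw [pow_add]
    ring

theorem sum_eq_sum_diag_add_sum_lt_add_sum_gt (s : Finset (ℕ × ℕ)) (f : ℕ × ℕ → ℚ) :
    ∑ p ∈ s, f p = ∑ p ∈ s with p.1 = p.2, f p + ∑ p ∈ s with p.1 < p.2, f p +
      ∑ p ∈ s with p.2 < p.1, f p := by
  simp only [sum_filter, ← sum_add_distrib]
  refine sum_congr rfl fun p _ => ?_
  rcases lt_trichotomy p.1 p.2 with h | h | h
  · simp [h, h.ne, h.not_gt]
  · simp [h]
  · simp [h, h.ne', h.not_gt]

/-- Splitting the summation indices `m, m'` of a product of two Lambert series according to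
`m = m'`, `m < m'` and `m' < m`. -/
theorem lambert_mul_lambert {d d' : ℕ} (hd : 1 ≤ d) (hd' : 1 ≤ d') (e a b : ℕ) :
    lambert e a d * lambert e b d' = lambert e (a + b) (d + d') +
      (∑ j ∈ range (b + 1), (b.choose j : ℚ) •
        (lambert e (a + (b - j)) (d + d') * lambert 1 j d')) +
      ∑ j ∈ range (a + 1), (a.choose j : ℚ) •
        (lambert e (b + (a - j)) (d + d') * lambert 1 j d) := by
  ext N
  have h3 := coeff_sum_lambert_shift hd' hd e b a (Nat.lt_succ_self N)
  rw [add_comm d' d] at h3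
  rw [map_add, map_add, coeff_sum_lambert_shift hd hd' e a b (Nat.lt_succ_self N), h3,
    coeff_lambert_mul_lambert hd hd' _ _ _ _ (Nat.lt_succ_self N),
    coeff_lambert (Nat.le_add_right_of_le hd : 1 ≤ d + d') _ _ (Nat.lt_succ_self N),
    sum_eq_sum_diag_add_sum_lt_add_sum_gt, filter_filter, filter_filter, filter_filter,
    ← sum_filter]
  refine congrArg₂ (· + ·) (congrArg₂ (· + ·) ?_ rfl) ?_
  · refine sum_nbij' (fun p => p.1) (fun m => (m, m)) ?_ ?_ ?_ ?_ ?_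
    · rintro ⟨m, k⟩ h
      simp only [mem_filter, mem_product, mem_Ico] at h ⊢
      obtain ⟨⟨h1, h2⟩, h3, rfl⟩ := h
      exact ⟨h1, by rw [← h3]; ring⟩
    · intro m h
      simp only [mem_filter, mem_product, mem_Ico] at h ⊢
      exact ⟨⟨h.1, h.1⟩, by rw [← h.2]; ring, trivial⟩
    · rintro ⟨m, k⟩ h
      simp only [mem_filter] at h
      simp [h.2.2]
    · simp
    · rintro ⟨m, k⟩ h
      simp only [mem_filter] at h
      obtain ⟨-, -, rfl⟩ := h
      rw [pow_add]
  · refine sum_nbij' Prod.swap Prod.swap ?_ ?_ (by simp) (by simp)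
      (fun p _ => by simp [mul_comm])
    · rintro ⟨m, k⟩ h
      simp only [mem_filter, mem_product, mem_Ico, Prod.swap_prod_mk] at h ⊢
      exact ⟨⟨h.1.2, h.1.1⟩, by omega, by omega⟩
    · rintro ⟨m, k⟩ h
      simp only [mem_filter, mem_product, mem_Ico, Prod.swap_prod_mk] at h ⊢
      exact ⟨⟨h.1.2, h.1.1⟩, by omega, by omega⟩

/-- The series `∑_{d ≥ 1} d ^ t Y ^ d` over `ℚ⟦X⟧`. -/
noncomputable def outerPowSeries (t : ℕ) : PowerSeries (PowerSeries ℚ) :=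
  PowerSeries.map PowerSeries.C (powSeries 1 t)

theorem coeff_outerPowSeries (t d : ℕ) : PowerSeries.coeff d (outerPowSeries t) =
    PowerSeries.C (if d < 1 then 0 else (d : ℚ) ^ t) := by
  rw [outerPowSeries, PowerSeries.coeff_map, coeff_powSeries]

theorem exists_outerPowSeries_mul (t s : ℕ) : ∃ c : ℕ → ℚ,
    outerPowSeries t * outerPowSeries s = ∑ j ∈ range (t + s + 2), c j • outerPowSeries j := by
  obtain ⟨c, hc⟩ := exists_powSeries_one_mul_one t s
  refine ⟨c, ?_⟩
  rw [outerPowSeries, outerPowSeries, ← map_mul, hc, map_sum]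
  refine sum_congr rfl fun j _ => PowerSeries.ext fun d => ?_
  rw [PowerSeries.coeff_map, PowerSeries.coeff_smul, PowerSeries.coeff_smul, outerPowSeries,
    PowerSeries.coeff_map, smul_eq_mul, map_mul, PowerSeries.smul_eq_C_mul]

/-- Multiplication of the `d`-th coefficient by `lambert e a d`. -/
noncomputable def lambertOp (e a : ℕ) :
    PowerSeries (PowerSeries ℚ) →ₗ[ℚ] PowerSeries (PowerSeries ℚ) where
  toFun f := PowerSeries.mk fun d => lambert e a d * PowerSeries.coeff d f
  map_add' f g := by
    refine PowerSeries.ext fun d => ?_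
    simp [mul_add]
  map_smul' c f := by
    refine PowerSeries.ext fun d => ?_
    simp

theorem coeff_lambertOp (e a d : ℕ) (f : PowerSeries (PowerSeries ℚ)) :
    PowerSeries.coeff d (lambertOp e a f) = lambert e a d * PowerSeries.coeff d f := by
  simp [lambertOp]

theorem lambertOp_mul_lambertOp (e a b : ℕ) {f g : PowerSeries (PowerSeries ℚ)}
    (hf : PowerSeries.coeff 0 f = 0) (hg : PowerSeries.coeff 0 g = 0) :
    lambertOp e a f * lambertOp e b g = lambertOp e (a + b) (f * g) +
      (∑ j ∈ range (b + 1), (b.choose j : ℚ) •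
        lambertOp e (a + (b - j)) (f * lambertOp 1 j g)) +
      ∑ j ∈ range (a + 1), (a.choose j : ℚ) •
        lambertOp e (b + (a - j)) (lambertOp 1 j f * g) := by
  refine PowerSeries.ext fun D => ?_
  simp only [map_add, map_sum, PowerSeries.coeff_smul, coeff_lambertOp, PowerSeries.coeff_mul,
    mul_sum, smul_sum]
  rw [sum_comm, sum_comm (s := range (a + 1)), ← sum_add_distrib, ← sum_add_distrib]
  refine sum_congr rfl fun p hp => ?_
  rw [HasAntidiagonal.mem_antidiagonal] at hp
  rcases Nat.eq_zero_or_pos p.1 with h1 | h1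
  · simp [h1, hf]
  rcases Nat.eq_zero_or_pos p.2 with h2 | h2
  · simp [h2, hg]
  rw [mul_mul_mul_comm, lambert_mul_lambert h1 h2, hp, add_mul, add_mul, sum_mul, sum_mul]
  refine congrArg₂ (· + ·) (congrArg₂ (· + ·) rfl ?_) ?_ <;>
  · refine sum_congr rfl fun j _ => ?_
    rw [smul_mul_assoc]
    congr 1
    ring

/-- The weight of a word of pairs of exponents. -/
def wordWeight (w : List (ℕ × ℕ)) : ℕ := (w.map fun p => p.1 + p.2 + 1).sum

theorem wordWeight_cons (a b : ℕ) (w : List (ℕ × ℕ)) :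
    wordWeight ((a, b) :: w) = a + b + 1 + wordWeight w := by
  simp [wordWeight]

/-- The generating series, in the variable `Y` recording the sum of the `dᵢ`, of the ordered sums
`∑_{n₁ < ⋯ < n_ℓ}`, expressed through the differences of consecutive `nᵢ`. -/
noncomputable def nestedSeries : List (ℕ × ℕ) → PowerSeries (PowerSeries ℚ)
  | [] => 1
  | (a, t) :: w => lambertOp 1 a (outerPowSeries t * nestedSeries w)

/-- The span of the series `nestedSeries w` with `w` of weight at most `k`. -/
noncomputable def nestedSpan (k : ℕ) : Submodule ℚ (PowerSeries (PowerSeries ℚ)) :=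
  Submodule.span ℚ {x | ∃ w, wordWeight w ≤ k ∧ nestedSeries w = x}

/-- The variant of `nestedSpan` for nonempty words in which the smallest `nᵢ` is only required to
be at least `e`. -/
noncomputable def nestedSpanFrom (e k : ℕ) : Submodule ℚ (PowerSeries (PowerSeries ℚ)) :=
  Submodule.span ℚ {x | ∃ a t w, a + t + 1 + wordWeight w ≤ k ∧
    lambertOp e a (outerPowSeries t * nestedSeries w) = x}

theorem nestedSpanFrom_one_le (k : ℕ) : nestedSpanFrom 1 k ≤ nestedSpan k := by
  refine Submodule.span_mono ?_
  rintro _ ⟨a, t, w, h, rfl⟩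
  exact ⟨(a, t) :: w, by rwa [wordWeight_cons], rfl⟩

theorem lambertOp_mem_nestedSpanFrom (e a t : ℕ) {k m : ℕ} {x : PowerSeries (PowerSeries ℚ)}
    (hx : x ∈ nestedSpan m) (hk : a + t + 1 + m ≤ k) :
    lambertOp e a (outerPowSeries t * x) ∈ nestedSpanFrom e k := by
  induction hx using Submodule.span_induction with
  | mem x hx =>
    obtain ⟨w, hw, rfl⟩ := hx
    exact Submodule.subset_span ⟨a, t, w, by omega, rfl⟩
  | zero => simp
  | add x y _ _ hx hy =>
    rw [mul_add, map_add]
    exact add_mem hx hy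
  | smul c x _ hx =>
    rw [mul_smul_comm, map_smul]
    exact Submodule.smul_mem _ _ hx

theorem lambertOp_mul_mem_nestedSpanFrom (e a t s : ℕ) {k m : ℕ}
    {x : PowerSeries (PowerSeries ℚ)} (hx : x ∈ nestedSpan m) (hk : a + t + s + 2 + m ≤ k) :
    lambertOp e a (outerPowSeries t * outerPowSeries s * x) ∈ nestedSpanFrom e k := by
  obtain ⟨c, hc⟩ := exists_outerPowSeries_mul t s
  rw [hc, sum_mul, map_sum]
  refine sum_mem fun j hj => ?_
  rw [mem_range] at hj
  rw [smul_mul_assoc, map_smul]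
  exact Submodule.smul_mem _ _ (lambertOp_mem_nestedSpanFrom e a j hx (by omega))

theorem coeff_zero_outerPowSeries_mul (t : ℕ) (x : PowerSeries (PowerSeries ℚ)) :
    PowerSeries.coeff 0 (outerPowSeries t * x) = 0 := by
  simp [PowerSeries.coeff_mul, coeff_outerPowSeries]

theorem lambertOp_mul_lambertOp_mem (e a t b s : ℕ) (v v' : List (ℕ × ℕ))
    (h : nestedSeries v * nestedSeries v' ∈ nestedSpan (wordWeight v + wordWeight v'))
    (hl : ∀ j, nestedSeries ((j, t) :: v) * nestedSeries v' ∈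
      nestedSpan (wordWeight ((j, t) :: v) + wordWeight v'))
    (hr : ∀ j, nestedSeries v * nestedSeries ((j, s) :: v') ∈
      nestedSpan (wordWeight v + wordWeight ((j, s) :: v'))) :
    lambertOp e a (outerPowSeries t * nestedSeries v) *
      lambertOp e b (outerPowSeries s * nestedSeries v') ∈
      nestedSpanFrom e (wordWeight ((a, t) :: v) + wordWeight ((b, s) :: v')) := by
  simp only [wordWeight_cons] at *
  rw [lambertOp_mul_lambertOp e a b (coeff_zero_outerPowSeries_mul t _)
    (coeff_zero_outerPowSeries_mul s _)]
  refine add_mem (add_mem ?_ (sum_mem fun j hj => Submodule.smul_mem _ _ ?_))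
    (sum_mem fun j hj => Submodule.smul_mem _ _ ?_)
  · rw [mul_mul_mul_comm]
    exact lambertOp_mul_mem_nestedSpanFrom e _ t s h (by omega)
  · rw [mem_range] at hj
    rw [mul_assoc]
    exact lambertOp_mem_nestedSpanFrom e _ t (hr j) (by omega)
  · rw [mem_range] at hj
    rw [mul_left_comm]
    exact lambertOp_mem_nestedSpanFrom e _ s (hl j) (by omega)

theorem nestedSeries_mul_mem : ∀ w w' : List (ℕ × ℕ),
    nestedSeries w * nestedSeries w' ∈ nestedSpan (wordWeight w + wordWeight w')
  | [], w' => Submodule.subset_span ⟨w', by simp [wordWeight], by simp [nestedSeries]⟩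
  | (a, t) :: v, [] =>
    Submodule.subset_span ⟨(a, t) :: v, by simp [wordWeight], by simp [nestedSeries]⟩
  | (a, t) :: v, (b, s) :: v' =>
    nestedSpanFrom_one_le _ (lambertOp_mul_lambertOp_mem 1 a t b s v v'
      (nestedSeries_mul_mem v v') (fun j => nestedSeries_mul_mem ((j, t) :: v) v')
      (fun j => nestedSeries_mul_mem v ((j, s) :: v')))
termination_by w w' => w.length + w'.length

theorem mul_mem_nestedSpanFrom {e k l : ℕ} {x y : PowerSeries (PowerSeries ℚ)}
    (hx : x ∈ nestedSpanFrom e k) (hy : y ∈ nestedSpanFrom e l) :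
    x * y ∈ nestedSpanFrom e (k + l) := by
  have h := Submodule.mul_mem_mul hx hy
  rw [nestedSpanFrom, nestedSpanFrom, Submodule.span_mul_span] at h
  refine Submodule.span_le.2 ?_ h
  rintro _ ⟨_, ⟨a, t, v, hv, rfl⟩, _, ⟨b, s, v', hv', rfl⟩, rfl⟩
  refine Submodule.span_mono ?_ (lambertOp_mul_lambertOp_mem e a t b s v v'
    (nestedSeries_mul_mem _ _) (fun j => nestedSeries_mul_mem _ _)
    (fun j => nestedSeries_mul_mem _ _))
  rintro _ ⟨a', t', w, hw, rfl⟩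
  rw [wordWeight_cons, wordWeight_cons] at hw
  exact ⟨a', t', w, by omega, rfl⟩

theorem prod_mem_nestedSpanFrom {ι : Type*} (e : ℕ) (u t : ι → ℕ) {s : Finset ι}
    (hs : s.Nonempty) : ∏ i ∈ s, lambertOp e (u i) (outerPowSeries (t i)) ∈
      nestedSpanFrom e (∑ i ∈ s, (u i + t i + 1)) := by
  have h1 : ∀ i, lambertOp e (u i) (outerPowSeries (t i)) ∈
      nestedSpanFrom e (u i + t i + 1) := fun i =>
    Submodule.subset_span ⟨u i, t i, [], by simp [wordWeight], by simp [nestedSeries]⟩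
  induction hs using Finset.Nonempty.cons_induction with
  | singleton i => simpa using h1 i
  | cons i s hi hs ih =>
    rw [prod_cons, sum_cons]
    exact mul_mem_nestedSpanFrom (h1 i) ih

theorem lambert_zero_right (e a : ℕ) : lambert e a 0 = 0 := by
  simp [lambert]

/-- The truncated bracket `∑_{D > u₁ > ⋯ > u_ℓ > 0} ∏ uᵢ ^ bᵢ ∑_{vᵢ ≥ 1} vᵢ ^ aᵢ q ^ (uᵢ vᵢ)`. -/
noncomputable def truncBracket : List (ℕ × ℕ) → ℕ → PowerSeries ℚ
  | [], _ => 1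
  | (a, b) :: w, D => ∑ u ∈ range D, (u : ℚ) ^ b • (lambert 1 a u * truncBracket w u)

/-- The span of the truncated brackets of weight at most `k`. -/
noncomputable def bracketSpan (k : ℕ) : Submodule ℚ (ℕ → PowerSeries ℚ) :=
  Submodule.span ℚ {f | ∃ w, wordWeight w ≤ k ∧ truncBracket w = f}

/-- The span of the truncated brackets multiplied by powers of the truncation parameter. -/
noncomputable def powBracketSpan (k : ℕ) : Submodule ℚ (ℕ → PowerSeries ℚ) :=
  Submodule.span ℚ {f | ∃ b w, b + wordWeight w ≤ k ∧
    (fun D : ℕ => (D : ℚ) ^ b • truncBracket w D) = f}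

theorem sum_sub_pow_smul_mem_powBracketSpan (t a : ℕ) {k m : ℕ} {F : ℕ → PowerSeries ℚ}
    (hF : F ∈ powBracketSpan m) (hk : t + a + 1 + m ≤ k) :
    (fun D : ℕ => ∑ j ∈ range D, ((D : ℚ) - j) ^ t • (lambert 1 a j * F j)) ∈ powBracketSpan k := by
  induction hF using Submodule.span_induction with
  | mem F hF =>
    obtain ⟨b, w, hw, rfl⟩ := hF
    have h : (fun D : ℕ => ∑ j ∈ range D,
        ((D : ℚ) - j) ^ t • (lambert 1 a j * ((j : ℚ) ^ b • truncBracket w j))) =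
        ∑ i ∈ range (t + 1), ((-1 : ℚ) ^ (t - i) * t.choose i) •
          fun D : ℕ => (D : ℚ) ^ i • truncBracket ((a, b + (t - i)) :: w) D := by
      funext D
      simp only [Finset.sum_apply, Pi.smul_apply, truncBracket, smul_sum]
      rw [sum_comm]
      refine sum_congr rfl fun j _ => ?_
      rw [sub_eq_add_neg, add_pow, sum_smul]
      refine sum_congr rfl fun i _ => ?_
      rw [mul_smul_comm, smul_smul, smul_smul, smul_smul]
      congr 1
      rw [neg_pow, pow_add]
      ring
    rw [h]
    refine sum_mem fun i hi => Submodule.smul_mem _ _ (Submodule.subset_span ⟨i, _, ?_, rfl⟩)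
    rw [mem_range] at hi
    rw [wordWeight_cons]
    omega
  | zero =>
    simp only [Pi.zero_apply, mul_zero, smul_zero, sum_const_zero]
    exact zero_mem _
  | add x y _ _ hx hy =>
    simp only [Pi.add_apply, mul_add, smul_add, sum_add_distrib]
    exact add_mem hx hy
  | smul c x _ hx =>
    simp only [Pi.smul_apply, mul_smul_comm, smul_comm _ c, ← smul_sum]
    exact Submodule.smul_mem _ c hx

/-- The change of variables from the `dᵢ` to their partial sums. -/
theorem exists_coeff_nestedSeries_eq (w : List (ℕ × ℕ)) (t : ℕ) :
    ∃ F ∈ powBracketSpan (t + wordWeight w), ∀ D, 1 ≤ D →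
      PowerSeries.coeff D (outerPowSeries t * nestedSeries w) = F D := by
  induction w generalizing t with
  | nil =>
    refine ⟨_, Submodule.subset_span ⟨t, [], le_rfl, rfl⟩, fun D hD => ?_⟩
    have hD' : ¬ D < 1 := by omega
    simp [nestedSeries, truncBracket, coeff_outerPowSeries, hD', PowerSeries.smul_eq_C_mul]
  | cons p v ih =>
    obtain ⟨a, s⟩ := p
    obtain ⟨F, hF, hFD⟩ := ih s
    refine ⟨_, sum_sub_pow_smul_mem_powBracketSpan t a hF ?_, fun D hD => ?_⟩
    · rw [wordWeight_cons]
      omega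
    rw [nestedSeries, mul_comm, PowerSeries.coeff_mul,
      Finset.Nat.sum_antidiagonal_eq_sum_range_succ_mk, sum_range_succ]
    simp only [Nat.sub_self, coeff_outerPowSeries, zero_lt_one, if_true, map_zero, mul_zero,
      add_zero, coeff_lambertOp]
    refine sum_congr rfl fun j hj => ?_
    rw [mem_range] at hj
    rcases Nat.eq_zero_or_pos j with rfl | hj0
    · simp [lambert_zero_right]
    rw [hFD j hj0, if_neg (by omega), Nat.cast_sub hj.le, PowerSeries.smul_eq_C_mul, mul_comm]

theorem sum_range_mul_sum_range {A : Type*} [CommRing A] (f g : ℕ → A) (D : ℕ) :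
    (∑ u ∈ range D, f u) * ∑ u ∈ range D, g u =
      ∑ u ∈ range D, (f u * ∑ v ∈ range u, g v + g u * ∑ v ∈ range u, f v + f u * g u) := by
  induction D with
  | zero => simp
  | succ D ih =>
    simp only [sum_range_succ _ D, ← ih]
    ring

theorem sum_lambert_mem_bracketSpan (a b : ℕ) {k m : ℕ} {F : ℕ → PowerSeries ℚ}
    (hF : F ∈ bracketSpan m) (hk : a + b + 1 + m ≤ k) :
    (fun D => ∑ u ∈ range D, (u : ℚ) ^ b • (lambert 1 a u * F u)) ∈ bracketSpan k := by
  induction hF using Submodule.span_induction with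
  | mem F hF =>
    obtain ⟨w, hw, rfl⟩ := hF
    refine Submodule.subset_span ⟨(a, b) :: w, ?_, rfl⟩
    rw [wordWeight_cons]
    omega
  | zero =>
    simp only [Pi.zero_apply, mul_zero, smul_zero, sum_const_zero]
    exact zero_mem _
  | add x y _ _ hx hy =>
    simp only [Pi.add_apply, mul_add, smul_add, sum_add_distrib]
    exact add_mem hx hy
  | smul c x _ hx =>
    simp only [Pi.smul_apply, mul_smul_comm, smul_comm _ c, ← smul_sum]
    exact Submodule.smul_mem _ c hx

/-- The quasi-shuffle product of truncated brackets. -/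
theorem truncBracket_mul_mem : ∀ w w' : List (ℕ × ℕ),
    truncBracket w * truncBracket w' ∈ bracketSpan (wordWeight w + wordWeight w')
  | [], w' => Submodule.subset_span ⟨w', by simp [wordWeight], by
      funext D
      simp [truncBracket]⟩
  | (a, b) :: v, [] => Submodule.subset_span ⟨(a, b) :: v, by simp [wordWeight], by
      funext D
      simp [truncBracket]⟩
  | (a, b) :: v, (a', b') :: v' => by
    obtain ⟨c, hc⟩ := exists_lambert_one_mul_one a a'
    have h : truncBracket ((a, b) :: v) * truncBracket ((a', b') :: v') =
        (fun D => ∑ u ∈ range D, (u : ℚ) ^ b •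
          (lambert 1 a u * (truncBracket v * truncBracket ((a', b') :: v')) u)) +
        (fun D => ∑ u ∈ range D, (u : ℚ) ^ b' •
          (lambert 1 a' u * (truncBracket ((a, b) :: v) * truncBracket v') u)) +
        ∑ j ∈ range (a + a' + 2), c j • fun D => ∑ u ∈ range D, (u : ℚ) ^ (b + b') •
          (lambert 1 j u * (truncBracket v * truncBracket v') u) := by
      funext D
      simp only [Pi.add_apply, Pi.mul_apply, Finset.sum_apply, Pi.smul_apply, smul_sum]
      rw [truncBracket, truncBracket, sum_range_mul_sum_range, sum_comm (s := range (a + a' + 2)),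
        ← sum_add_distrib, ← sum_add_distrib]
      refine sum_congr rfl fun u _ => ?_
      refine congrArg₂ (· + ·) (congrArg₂ (· + ·) ?_ ?_) ?_
      · rw [smul_mul_assoc, mul_assoc, ← truncBracket]
      · rw [smul_mul_assoc, mul_assoc, ← truncBracket, mul_comm (truncBracket v' u)]
      · rw [smul_mul_smul_comm, mul_mul_mul_comm, hc, ← pow_add, sum_mul, smul_sum]
        refine sum_congr rfl fun j _ => ?_
        rw [smul_mul_assoc, smul_comm]
    rw [h]
    have h1 := truncBracket_mul_mem v ((a', b') :: v')
    have h2 := truncBracket_mul_mem ((a, b) :: v) v'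
    have h3 := truncBracket_mul_mem v v'
    simp only [wordWeight_cons] at *
    refine add_mem (add_mem (sum_lambert_mem_bracketSpan a b h1 (by omega))
      (sum_lambert_mem_bracketSpan a' b' h2 (by omega)))
      (sum_mem fun j hj => Submodule.smul_mem _ _ ?_)
    rw [mem_range] at hj
    exact sum_lambert_mem_bracketSpan j (b + b') h3 (by omega)
termination_by w w' => w.length + w'.length

theorem pow_smul_mem_powBracketSpan (b : ℕ) {k m : ℕ} {F : ℕ → PowerSeries ℚ}
    (hF : F ∈ bracketSpan m) (hk : b + m ≤ k) :
    (fun D : ℕ => (D : ℚ) ^ b • F D) ∈ powBracketSpan k := by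
  induction hF using Submodule.span_induction with
  | mem F hF =>
    obtain ⟨w, hw, rfl⟩ := hF
    exact Submodule.subset_span ⟨b, w, by omega, rfl⟩
  | zero =>
    simp only [Pi.zero_apply, smul_zero]
    exact zero_mem _
  | add x y _ _ hx hy =>
    simp only [Pi.add_apply, smul_add]
    exact add_mem hx hy
  | smul c x _ hx =>
    simp only [Pi.smul_apply, smul_comm _ c]
    exact Submodule.smul_mem _ c hx

theorem mul_mem_powBracketSpan {k l : ℕ} {F G : ℕ → PowerSeries ℚ}
    (hF : F ∈ powBracketSpan k) (hG : G ∈ powBracketSpan l) : F * G ∈ powBracketSpan (k + l) := by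
  have h := Submodule.mul_mem_mul hF hG
  rw [powBracketSpan, powBracketSpan, Submodule.span_mul_span] at h
  refine Submodule.span_le.2 ?_ h
  rintro _ ⟨_, ⟨b, v, hv, rfl⟩, _, ⟨b', v', hv', rfl⟩, rfl⟩
  have h' := pow_smul_mem_powBracketSpan (b + b') (truncBracket_mul_mem v v')
    (by omega : _ ≤ k + l)
  simp only [Pi.mul_apply, pow_add, ← smul_mul_smul_comm] at h'
  exact h'

theorem truncBracket_ofFn (n : ℕ) (p : Fin n → ℕ × ℕ) (D : ℕ) :
    truncBracket (List.ofFn p) D =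
      ∑ u ∈ (Fintype.piFinset fun _ : Fin n => range D) with ∀ i j, i < j → u j < u i,
        ∏ i, (u i : ℚ) ^ (p i).2 • lambert 1 (p i).1 (u i) := by
  induction n generalizing D with
  | zero => simp [truncBracket]
  | succ n ih =>
    rw [List.ofFn_succ, truncBracket]
    simp only [ih, mul_sum, smul_sum]
    rw [sum_sigma']
    refine sum_nbij' (fun x => Fin.cons x.1 x.2) (fun u => ⟨u 0, Fin.tail u⟩) ?_ ?_ ?_ ?_ ?_
    · rintro ⟨x, u⟩ h
      simp only [mem_sigma, mem_filter, Fintype.mem_piFinset, mem_range] at h ⊢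
      obtain ⟨hx, hu, hlt⟩ := h
      refine ⟨Fin.cases hx fun i => ?_, Fin.cases (Fin.cases ?_ fun j => ?_)
        fun i => Fin.cases ?_ fun j => ?_⟩
      · simpa using (hu i).trans hx
      · simp
      · simpa using hu j
      · simp
      · simpa using hlt i j
    · intro u h
      simp only [mem_sigma, mem_filter, Fintype.mem_piFinset, mem_range] at h ⊢
      exact ⟨h.1 0, fun i => h.2 0 i.succ (Fin.succ_pos i),
        fun i j hij => h.2 i.succ j.succ (Fin.succ_lt_succ_iff.2 hij)⟩
    · rintro ⟨x, u⟩ h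
      simp
    · intro u h
      simp
    · rintro ⟨x, u⟩ h
      simp only [Fin.prod_univ_succ, Fin.cons_zero, Fin.cons_succ, smul_mul_assoc]

theorem coeff_truncBracket_ofFn (n : ℕ) (p : Fin n → ℕ × ℕ) (N : ℕ) :
    PowerSeries.coeff N (truncBracket (List.ofFn p) (N + 1)) =
      (∏ i, ((p i).2.factorial * (p i).1.factorial : ℚ)) *
        PowerSeries.coeff N (bibracket n (fun i => (p i).1 + 1) fun i => (p i).2) := by
  rw [truncBracket_ofFn, bibracket, PowerSeries.coeff_mk, map_sum, sum_filter, sum_filter,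
    sum_product, mul_sum]
  refine sum_congr rfl fun u _ => ?_
  by_cases hu : ∀ i, 1 ≤ u i
  swap
  · have h0 : ∀ v : Fin n → ℕ, ¬ ((∀ i, 1 ≤ u i) ∧ (∀ i, 1 ≤ v i) ∧
        (∀ i j : Fin n, i < j → u j < u i) ∧ (∑ i, u i * v i) = N) := fun v h => hu h.1
    simp only [h0, if_false, sum_const_zero, mul_zero]
    push Not at hu
    obtain ⟨i, hi⟩ := hu
    have hi0 : u i = 0 := by omega
    rw [prod_eq_zero (mem_univ i) (by rw [hi0, lambert_zero_right, smul_zero])]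
    simp
  by_cases hlt : ∀ i j : Fin n, i < j → u j < u i
  swap
  · rw [if_neg hlt]
    simp [hlt]
  rw [if_pos hlt]
  have hfac : ∏ i, ((p i).2.factorial * (p i).1.factorial : ℚ) ≠ 0 :=
    prod_ne_zero_iff.2 fun i _ => by positivity
  rw [prod_smul, PowerSeries.coeff_smul, coeff_prod_lambert (Nat.lt_succ_self N) _ _ _ hu,
    smul_eq_mul, mul_sum, mul_sum]
  have hset : (Fintype.piFinset fun _ : Fin n => Ico 1 (N + 1)) =
      (Fintype.piFinset fun _ : Fin n => range (N + 1)).filter fun v => ∀ i, 1 ≤ v i := by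
    ext v
    simp only [Fintype.mem_piFinset, mem_Ico, mem_filter, mem_range, ← forall_and, and_comm]
  rw [Nat.succ_eq_add_one, hset, sum_filter]
  refine sum_congr rfl fun v _ => ?_
  by_cases hv : ∀ i, 1 ≤ v i
  swap
  · simp [hv]
  have hcomm : ∑ i, v i * u i = ∑ i, u i * v i := sum_congr rfl fun i _ => mul_comm _ _
  by_cases hN : ∑ i, u i * v i = N
  swap
  · rw [if_pos hv, if_neg (by rwa [hcomm]), if_neg fun h => hN h.2.2.2, mul_zero, mul_zero]
  rw [if_pos hv, if_pos (hcomm.trans hN), if_pos ⟨hu, hv, hlt, hN⟩, ← prod_mul_distrib,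
    ← prod_mul_distrib]
  refine prod_congr rfl fun i _ => ?_
  have h1 : ((p i).2.factorial : ℚ) ≠ 0 := by positivity
  have h2 : ((p i).1.factorial : ℚ) ≠ 0 := by positivity
  rw [Nat.add_sub_cancel]
  field_simp

/-- The sum `∑_D f D`, for a sequence of series such that `f D` has order at least `D`. -/
noncomputable def diagSum : (ℕ → PowerSeries ℚ) →ₗ[ℚ] PowerSeries ℚ where
  toFun f := PowerSeries.mk fun N => PowerSeries.coeff N (∑ D ∈ range (N + 1), f D)
  map_add' f g := by
    ext N
    simp [sum_add_distrib]
  map_smul' c f := by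
    ext N
    simp [mul_sum]

theorem coeff_diagSum (f : ℕ → PowerSeries ℚ) (N : ℕ) :
    PowerSeries.coeff N (diagSum f) = PowerSeries.coeff N (∑ D ∈ range (N + 1), f D) := by
  simp [diagSum]

/-- The span of the bi-brackets of weight at most `k` with first upper index at least `2`. -/
noncomputable def biBracketSpan (k : ℕ) : Submodule ℚ (PowerSeries ℚ) :=
  Submodule.span ℚ {x | ∃ (l : ℕ) (s r : Fin l → ℕ), (∀ i, 1 ≤ s i) ∧ ∑ i, (s i + r i) ≤ k ∧
    (∀ h : 0 < l, 2 ≤ s ⟨0, h⟩) ∧ bibracket l s r = x}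

theorem wordWeight_ofFn (n : ℕ) (p : Fin n → ℕ × ℕ) :
    wordWeight (List.ofFn p) = ∑ i, ((p i).1 + 1 + (p i).2) := by
  rw [wordWeight, List.map_ofFn, List.sum_ofFn]
  refine sum_congr rfl fun i _ => ?_
  simp only [Function.comp_apply]
  omega

theorem diagSum_truncBracket_mem {a b k : ℕ} {w : List (ℕ × ℕ)} (ha : 1 ≤ a)
    (hk : wordWeight ((a, b) :: w) ≤ k) :
    diagSum (fun D => (D : ℚ) ^ b • (lambert 1 a D * truncBracket w D)) ∈ biBracketSpan k := by
  obtain ⟨n, p, hp⟩ : ∃ n, ∃ p : Fin (n + 1) → ℕ × ℕ, (a, b) :: w = List.ofFn p :=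
    ⟨w.length, ((a, b) :: w).get, (List.ofFn_get _).symm⟩
  have h0 : (p 0).1 = a := by
    rw [List.ofFn_succ, List.cons.injEq] at hp
    rw [← hp.1]
  have h : diagSum (fun D => (D : ℚ) ^ b • (lambert 1 a D * truncBracket w D)) =
      (∏ i, ((p i).2.factorial * (p i).1.factorial : ℚ)) •
        bibracket (n + 1) (fun i => (p i).1 + 1) fun i => (p i).2 := by
    ext N
    rw [PowerSeries.coeff_smul, smul_eq_mul, ← coeff_truncBracket_ofFn, ← hp, truncBracket,
      coeff_diagSum]
  rw [h]
  rw [hp, wordWeight_ofFn] at hk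
  refine Submodule.smul_mem _ _ (Submodule.subset_span ⟨_, _, _, fun i => ?_, hk, fun h => ?_, rfl⟩)
  · omega
  · have : (p ⟨0, h⟩).1 = a := h0
    omega

theorem diagSum_lambert_mul_mem {a k m : ℕ} {F : ℕ → PowerSeries ℚ} (ha : 1 ≤ a)
    (hF : F ∈ powBracketSpan m) (hk : a + 1 + m ≤ k) :
    diagSum (fun D => lambert 1 a D * F D) ∈ biBracketSpan k := by
  induction hF using Submodule.span_induction with
  | mem F hF =>
    obtain ⟨b, w, hw, rfl⟩ := hF
    simp only [mul_smul_comm]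
    exact diagSum_truncBracket_mem ha (by rw [wordWeight_cons]; omega)
  | zero =>
    simp only [Pi.zero_apply, mul_zero]
    rw [show (fun _ : ℕ => (0 : PowerSeries ℚ)) = 0 from rfl, map_zero]
    exact zero_mem _
  | add x y _ _ hx hy =>
    simp only [Pi.add_apply, mul_add]
    exact (diagSum.map_add _ _).symm ▸ add_mem hx hy
  | smul c x _ hx =>
    simp only [Pi.smul_apply, mul_smul_comm]
    exact (diagSum.map_smul c _).symm ▸ Submodule.smul_mem _ c hx

theorem diagSum_coeff_mul_coeff_mem {k l : ℕ} {x y : PowerSeries (PowerSeries ℚ)}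
    (hx : x ∈ nestedSpanFrom 0 k) (hy : y ∈ nestedSpanFrom 1 l) :
    diagSum (fun D => PowerSeries.coeff D x * PowerSeries.coeff D y) ∈ biBracketSpan (k + l) := by
  induction hx, hy using Submodule.span_induction₂ with
  | mem_mem x y hx hy =>
    obtain ⟨a, t, w, hw, rfl⟩ := hx
    obtain ⟨b, s, w', hw', rfl⟩ := hy
    obtain ⟨F, hF, hFD⟩ := exists_coeff_nestedSeries_eq w t
    obtain ⟨G, hG, hGD⟩ := exists_coeff_nestedSeries_eq w' s
    obtain ⟨c, hc⟩ := exists_lambert_zero_mul_one a b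
    have h : (fun D => PowerSeries.coeff D (lambertOp 0 a (outerPowSeries t * nestedSeries w)) *
        PowerSeries.coeff D (lambertOp 1 b (outerPowSeries s * nestedSeries w'))) =
        ∑ j ∈ Icc 1 (a + b + 1), c j • fun D => lambert 1 j D * (F * G) D := by
      funext D
      simp only [Finset.sum_apply, Pi.smul_apply, coeff_lambertOp]
      rcases Nat.eq_zero_or_pos D with rfl | hD
      · simp [lambert_zero_right]
      rw [hFD D hD, hGD D hD, mul_mul_mul_comm, hc, sum_mul]
      simp only [smul_mul_assoc, Pi.mul_apply]
    rw [h, map_sum]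
    refine sum_mem fun j hj => ?_
    rw [mem_Icc] at hj
    rw [map_smul]
    exact Submodule.smul_mem _ _
      (diagSum_lambert_mul_mem hj.1 (mul_mem_powBracketSpan hF hG) (by omega))
  | zero_left y _ =>
    simp only [map_zero, zero_mul]
    rw [show (fun _ : ℕ => (0 : PowerSeries ℚ)) = 0 from rfl, map_zero]
    exact zero_mem _
  | zero_right x _ =>
    simp only [map_zero, mul_zero]
    rw [show (fun _ : ℕ => (0 : PowerSeries ℚ)) = 0 from rfl, map_zero]
    exact zero_mem _
  | add_left x y z _ _ _ hx hy =>
    simp only [map_add, add_mul]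
    exact (diagSum.map_add _ _).symm ▸ add_mem hx hy
  | add_right x y z _ _ _ hx hy =>
    simp only [map_add, mul_add]
    exact (diagSum.map_add _ _).symm ▸ add_mem hx hy
  | smul_left c x y _ _ h =>
    simp only [PowerSeries.coeff_smul, smul_mul_assoc]
    exact (diagSum.map_smul c _).symm ▸ Submodule.smul_mem _ c h
  | smul_right c x y _ _ h =>
    simp only [PowerSeries.coeff_smul, mul_smul_comm]
    exact (diagSum.map_smul c _).symm ▸ Submodule.smul_mem _ c h

theorem coeff_prod_lambertOp {ι : Type*} [Fintype ι] [DecidableEq ι] (e u t : ι → ℕ) {D M : ℕ}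
    (hD : D < M) :
    PowerSeries.coeff D (∏ i, lambertOp (e i) (u i) (outerPowSeries (t i))) =
      ∑ d ∈ Fintype.piFinset (fun _ : ι => Ico 1 M),
        if ∑ i, d i = D then ∏ i, (d i : ℚ) ^ t i • lambert (e i) (u i) (d i) else 0 := by
  refine coeff_prod_of_sum_monomial _ (fun _ => Ico 1 M) (fun _ m => m)
    (fun i m => (m : ℚ) ^ t i • lambert (e i) (u i) m) fun i n hn => ?_
  simp only [map_sum, PowerSeries.coeff_monomial, sum_ite_eq, mem_Ico]
  rw [coeff_lambertOp, coeff_outerPowSeries]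
  by_cases h : 1 ≤ n
  · rw [if_neg (by omega), if_pos ⟨h, by omega⟩, PowerSeries.smul_eq_C_mul, mul_comm]
  · rw [if_pos (by omega), if_neg (by omega), map_zero, mul_zero]

theorem sum_range_mul_eq_sum_ite {α β A : Type*} [CommRing A] (S : Finset α) (T : Finset β)
    (φ : α → ℕ) (ψ : β → ℕ) (F : α → A) (G : β → A) (M : ℕ) :
    ∑ D ∈ range M, (∑ a ∈ S, if φ a = D then F a else 0) * (∑ b ∈ T, if ψ b = D then G b else 0) =
      ∑ a ∈ S, ∑ b ∈ T, if φ a = ψ b ∧ φ a < M then F a * G b else 0 := by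
  simp only [sum_mul_sum]
  rw [sum_comm]
  refine sum_congr rfl fun a _ => ?_
  rw [sum_comm]
  refine sum_congr rfl fun b _ => ?_
  simp only [ite_mul, zero_mul, mul_ite, mul_zero, sum_ite_eq, mem_range]
  by_cases h : φ a < M <;> by_cases h' : φ a = ψ b <;> simp [h, h']

theorem sum_piFinset_fin_add {α A : Type*} [AddCommMonoid A] (r s : ℕ) (S : Finset α)
    (f : (Fin r → α) → (Fin s → α) → A) :
    ∑ a ∈ Fintype.piFinset (fun _ : Fin r => S), ∑ b ∈ Fintype.piFinset (fun _ : Fin s => S),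
      f a b = ∑ d ∈ Fintype.piFinset (fun _ : Fin (r + s) => S),
        f (fun i => d (Fin.castAdd s i)) fun i => d (Fin.natAdd r i) := by
  rw [← sum_product']
  refine sum_equiv (Fin.appendEquiv r s) (fun p => ?_) fun p _ => ?_
  · simp only [mem_product, Fintype.mem_piFinset, Fin.appendEquiv, Equiv.coe_fn_mk]
    constructor
    · intro h
      exact Fin.addCases (by simpa using h.1) (by simpa using h.2)
    · intro h
      exact ⟨fun i => by simpa using h (Fin.castAdd s i), fun i => by simpa using h (Fin.natAdd r i)⟩
  · simp [Fin.appendEquiv]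

theorem coeff_unordSum {r s : ℕ} (hs : 1 ≤ s) (u t : Fin (r + s) → ℕ) (N : ℕ) :
    PowerSeries.coeff N (unordSum r s u t) =
      ∑ d ∈ Fintype.piFinset (fun _ : Fin (r + s) => Ico 1 (N + 1)),
        if ∑ i, d (Fin.castAdd s i) = ∑ i, d (Fin.natAdd r i) ∧ ∑ i, d (Fin.castAdd s i) < N + 1
        then ∑ n ∈ Fintype.piFinset
            (fun i => Ico (Fin.append (fun _ : Fin r => 0) (fun _ : Fin s => 1) i) (N + 1)),
          if ∑ i, n i * d i = N then ∏ i, (n i : ℚ) ^ u i * (d i : ℚ) ^ t i else 0 else 0 := by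
  have hlow : ∀ d : Fin (r + s) → ℕ,
      ∑ i ∈ univ.filter (fun i : Fin (r + s) => (i : ℕ) < r), d i = ∑ i, d (Fin.castAdd s i) := by
    intro d
    rw [sum_filter, Fin.sum_univ_add]
    simp
  have hhigh : ∀ d : Fin (r + s) → ℕ,
      ∑ i ∈ univ.filter (fun i : Fin (r + s) => r ≤ (i : ℕ)), d i = ∑ i, d (Fin.natAdd r i) := by
    intro d
    rw [sum_filter, Fin.sum_univ_add]
    simp [Fin.is_lt, Nat.not_le.2]
  have hle : ∀ n d : Fin (r + s) → ℕ, ∀ i, n i * d i ≤ ∑ i, n i * d i := fun n d i =>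
    single_le_sum (f := fun i => n i * d i) (fun _ _ => Nat.zero_le _) (mem_univ i)
  rw [unordSum, PowerSeries.coeff_mk, ← sum_filter]
  simp only [← sum_filter]
  rw [sum_sigma']
  refine sum_nbij' (fun p => ⟨p.2, p.1⟩) (fun p => (p.2, p.1)) ?_ ?_ (fun _ _ => rfl)
    (fun _ _ => rfl) fun _ _ => rfl
  · rintro ⟨n, d⟩ h
    simp only [mem_filter, mem_product, Fintype.mem_piFinset, mem_range, hlow, hhigh] at h
    simp only [mem_sigma, mem_filter, Fintype.mem_piFinset, mem_Ico]
    obtain ⟨-, hd, hn, heq, hN⟩ := h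
    have hs' : ∑ i, d (Fin.castAdd s i) ≤ N := by
      rw [heq, ← hN, Fin.sum_univ_add]
      refine le_add_left (sum_le_sum fun i _ => Nat.le_mul_of_pos_left _ (hn _ ?_))
      simp
    have hdN : ∀ i, d i ≤ N := by
      refine Fin.addCases (fun i => ?_) fun i => ?_
      · exact (single_le_sum (f := fun i => d (Fin.castAdd s i))
          (fun _ _ => Nat.zero_le _) (mem_univ i)).trans hs'
      · exact (single_le_sum (f := fun i => d (Fin.natAdd r i))
          (fun _ _ => Nat.zero_le _) (mem_univ i)).trans (heq ▸ hs')
    refine ⟨⟨fun i => ⟨hd i, Nat.lt_succ_of_le (hdN i)⟩, heq, Nat.lt_succ_of_le hs'⟩,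
      fun i => ⟨?_, ?_⟩, hN⟩
    · refine Fin.addCases (fun i => ?_) (fun i => ?_) i
      · simp
      · simpa using hn (Fin.natAdd r i) (by simp)
    · exact Nat.lt_succ_of_le (hN ▸ (Nat.le_mul_of_pos_right _ (hd i)).trans (hle n d i))
  · rintro ⟨d, n⟩ h
    simp only [mem_sigma, mem_filter, Fintype.mem_piFinset, mem_Ico] at h
    simp only [mem_filter, mem_product, Fintype.mem_piFinset, mem_range, hlow, hhigh]
    obtain ⟨⟨hd, heq, -⟩, hn, hN⟩ := h
    have hM : N + 1 ≤ (r + s) * N + 2 := by nlinarith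
    refine ⟨⟨fun i => (hn i).2.trans_le hM, fun i => (hd i).2.trans_le hM⟩, fun i => (hd i).1,
      Fin.addCases (fun i hi => ?_) (fun i _ => ?_), heq, hN⟩
    · exact absurd hi (Nat.not_le.2 i.is_lt)
    · simpa using (hn (Fin.natAdd r i)).1

theorem unordSum_eq_diagSum {r s : ℕ} (hs : 1 ≤ s) (u t : Fin (r + s) → ℕ) :
    unordSum r s u t = diagSum fun D =>
      PowerSeries.coeff D (∏ i : Fin r, lambertOp 0 (u (Fin.castAdd s i))
        (outerPowSeries (t (Fin.castAdd s i)))) *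
      PowerSeries.coeff D (∏ i : Fin s, lambertOp 1 (u (Fin.natAdd r i))
        (outerPowSeries (t (Fin.natAdd r i)))) := by
  ext N
  rw [coeff_unordSum hs, coeff_diagSum, sum_congr rfl fun D hD => congrArg₂ (· * ·)
    (coeff_prod_lambertOp (fun _ => 0) (fun i => u (Fin.castAdd s i))
      (fun i => t (Fin.castAdd s i)) (mem_range.1 hD))
    (coeff_prod_lambertOp (fun _ => 1) (fun i => u (Fin.natAdd r i))
      (fun i => t (Fin.natAdd r i)) (mem_range.1 hD)),
    sum_range_mul_eq_sum_ite, sum_piFinset_fin_add, map_sum]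
  refine sum_congr rfl fun d hd => ?_
  rw [Fintype.mem_piFinset] at hd
  split_ifs
  swap
  · rw [map_zero]
  have hprod := Fin.prod_univ_add fun i => (d i : ℚ) ^ t i •
    lambert (Fin.append (fun _ : Fin r => 0) (fun _ : Fin s => 1) i) (u i) (d i)
  simp only [Fin.append_left, Fin.append_right] at hprod
  rw [← hprod, prod_smul, PowerSeries.coeff_smul,
    coeff_prod_lambert N.lt_succ_self _ _ _ fun i => (mem_Ico.1 (hd i)).1, smul_eq_mul, mul_sum]
  refine sum_congr rfl fun n _ => ?_
  rw [mul_ite, mul_zero, ← prod_mul_distrib]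
  simp only [mul_comm]

/-- Proposition 4.5: the unordered sum lies in the ℚ-span of bi-brackets;
it is a finite ℚ-linear combination of bi-brackets of weight at most ∑(uᵢ+tᵢ+1),
with first upper index ≥ 2 when all tᵢ ≥ 1. -/
theorem stmt13 (r s : ℕ) (hr : 1 ≤ r) (hs : 1 ≤ s) (u t : Fin (r + s) → ℕ) :
    ∃ (K : ℕ) (c : Fin K → ℚ) (l : Fin K → ℕ)
      (s' : (κ : Fin K) → Fin (l κ) → ℕ) (r' : (κ : Fin K) → Fin (l κ) → ℕ),
      unordSum r s u t = ∑ κ, c κ • bibracket (l κ) (s' κ) (r' κ) ∧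
      (∀ κ i, 1 ≤ s' κ i) ∧
      (∀ κ, (∑ i, (s' κ i + r' κ i)) ≤ ∑ i, (u i + t i + 1)) ∧
      ((∀ i, 1 ≤ t i) → ∀ κ (h : 0 < l κ), 2 ≤ s' κ ⟨0, h⟩) := by
  have hmem : unordSum r s u t ∈ biBracketSpan (∑ i, (u i + t i + 1)) := by
    rw [unordSum_eq_diagSum hs, Fin.sum_univ_add]
    exact diagSum_coeff_mul_coeff_mem
      (prod_mem_nestedSpanFrom 0 _ _ (univ_nonempty_iff.2 ⟨⟨0, hr⟩⟩))
      (prod_mem_nestedSpanFrom 1 _ _ (univ_nonempty_iff.2 ⟨⟨0, hs⟩⟩))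
  obtain ⟨K, c, g, hg⟩ := Submodule.mem_span_set'.1 hmem
  choose l s' r' h1 h2 h3 h4 using fun κ => (g κ).2
  exact ⟨K, c, l, s', r', by simp only [h4, hg], h1, h2, fun _ => h3⟩
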